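/- arXiv:1402.4642 — 5 statements merged into one kernel-verified Lean document; each statement's English description precedes it below -/
import Mathlib

section
/- Let G be a finite simple graph and let u, v be arbitrary vertices of G. Then B_u ⊆ B_v if and only if N[u] ⊆ N[v]. -/
/-- A *maxclique* of a graph is an inclusion-maximal clique. -/
def SimpleGraph.IsMaxclique {V : Type*} (G : SimpleGraph V) (C : Set V) : Prop :=
  G.IsClique C ∧ ∀ D : Set V, G.IsClique D → C ⊆ D → D = C

/-- The *bundle* `B_v` of a vertex `v`: the set of all maxcliques containing `v`. -/
def SimpleGraph.bundle {V : Type*} (G : SimpleGraph V) (v : V) : Set (Set V) :=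
  {C | G.IsMaxclique C ∧ v ∈ C}

/-- The closed neighborhood `N[v]` of a vertex `v`. -/
def SimpleGraph.closedNbhd {V : Type*} (G : SimpleGraph V) (v : V) : Set V :=
  {u | u = v ∨ G.Adj u v}

/-- In a finite graph every clique extends to a maxclique. -/
theorem SimpleGraph.IsClique.exists_isMaxclique_superset {V : Type*} [Finite V]
    {G : SimpleGraph V} {s : Set V} (hs : G.IsClique s) : ∃ C, G.IsMaxclique C ∧ s ⊆ C := by
  obtain ⟨C, hsC, hC⟩ := Finite.exists_le_maximal hs
  exact ⟨C, ⟨hC.prop, fun D hD hCD => (hC.eq_of_subset hD hCD).symm⟩, hsC⟩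

/-- For arbitrary vertices `u, v`: `B_u ⊆ B_v` iff `N[u] ⊆ N[v]`. -/
theorem stmt5 {V : Type*} [Fintype V] (G : SimpleGraph V) (u v : V) :
    G.bundle u ⊆ G.bundle v ↔ G.closedNbhd u ⊆ G.closedNbhd v := by
  constructor
  · intro h w hw
    have hclique : G.IsClique {w, u} :=
      SimpleGraph.isClique_pair.2 fun hne => hw.resolve_left hne
    obtain ⟨C, hC, hsub⟩ := hclique.exists_isMaxclique_superset
    have hvC : v ∈ C := (h ⟨hC, hsub (by simp)⟩).2
    exact or_iff_not_imp_left.2 fun hne => hC.1 (hsub (by simp)) hvC hne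
  · rintro h C ⟨hC, huC⟩
    refine ⟨hC, ?_⟩
    have hins : G.IsClique (insert v C) := hC.1.insert fun w hwC hne => by
      have hwu : w ∈ G.closedNbhd u := or_iff_not_imp_left.2 fun hwu => hC.1 hwC huC hwu
      exact ((h hwu).resolve_left hne.symm).symm
    rw [← hC.2 _ hins (Set.subset_insert v C)]
    exact Set.mem_insert v C
end

section
/- Let G be a finite simple graph and let u, v be adjacent vertices of G. Then B_u ∪ B_v = C(G) (i.e., every maxclique of G contains u or v) if and only if the following three conditions all hold: (a) N[u] ∪ N[v] = V(G); (b) for every vertex w ∈ N[u] \ N[v] one has N[w] ⊆ N[u]; (c) for every vertex w ∈ N[v] \ N[u] one has N[w] ⊆ N[v]. -/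
namespace SimpleGraph

variable {V : Type*} {G : SimpleGraph V}

theorem IsClique.subset_closedNbhd {C : Set V} (hC : G.IsClique C) {v : V} (hv : v ∈ C) :
    C ⊆ G.closedNbhd v := fun w hw => by
  by_cases h : w = v
  · exact Or.inl h
  · exact Or.inr (hC hw hv h)

theorem IsMaxclique.mem_of_subset_closedNbhd {C : Set V} (hC : G.IsMaxclique C) {v : V}
    (h : C ⊆ G.closedNbhd v) : v ∈ C := by
  have hins : G.IsClique (insert v C) :=
    hC.1.insert fun w hw hne => ((h hw).resolve_left hne.symm).symm
  exact hC.2 _ hins (Set.subset_insert v C) ▸ Set.mem_insert v C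

theorem IsClique.exists_isMaxclique_superset_s6 [Finite V] {C : Set V} (hC : G.IsClique C) :
    ∃ D, C ⊆ D ∧ G.IsMaxclique D := by
  obtain ⟨D, hCD, hD⟩ := Finite.exists_le_maximal hC
  exact ⟨D, hCD, hD.prop, fun E hE hDE => (hD.eq_of_subset hE hDE).symm⟩

theorem exists_isMaxclique_of_mem_closedNbhd [Finite V] {u v : V} (h : u ∈ G.closedNbhd v) :
    ∃ C, G.IsMaxclique C ∧ u ∈ C ∧ v ∈ C := by
  have hclique : G.IsClique {u, v} := by
    rw [isClique_pair]
    exact fun hne => h.resolve_left hne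
  obtain ⟨C, hsub, hC⟩ := hclique.exists_isMaxclique_superset_s6
  exact ⟨C, hC, hsub (Set.mem_insert _ _), hsub (Set.mem_insert_of_mem _ rfl)⟩

theorem bundle_union_bundle_eq_iff {u v : V} :
    G.bundle u ∪ G.bundle v = {C | G.IsMaxclique C} ↔
      ∀ C, G.IsMaxclique C → u ∈ C ∨ v ∈ C := by
  simp only [Set.ext_iff, bundle, Set.mem_union, Set.mem_ofPred_eq]
  grind

theorem closedNbhd_subset_of_forall_isMaxclique [Finite V] {u v w : V}
    (h : ∀ C, G.IsMaxclique C → u ∈ C ∨ v ∈ C) (hw : w ∉ G.closedNbhd v) :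
    G.closedNbhd w ⊆ G.closedNbhd u := fun y hy => by
  obtain ⟨C, hC, hyC, hwC⟩ := exists_isMaxclique_of_mem_closedNbhd hy
  rcases h C hC with hu | hv
  · exact hC.1.subset_closedNbhd hu hyC
  · exact absurd (hC.1.subset_closedNbhd hv hwC) hw

end SimpleGraph

/-- For adjacent `u, v`: `B_u ∪ B_v = C(G)` iff (a) `N[u] ∪ N[v] = V(G)`,
(b) every `w ∈ N[u] \ N[v]` has `N[w] ⊆ N[u]`, and
(c) every `w ∈ N[v] \ N[u]` has `N[w] ⊆ N[v]`. -/
theorem stmt6 {V : Type*} [Fintype V] (G : SimpleGraph V) (u v : V) (huv : G.Adj u v) :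
    G.bundle u ∪ G.bundle v = {C | G.IsMaxclique C} ↔
      (G.closedNbhd u ∪ G.closedNbhd v = Set.univ ∧
       (∀ w ∈ G.closedNbhd u \ G.closedNbhd v, G.closedNbhd w ⊆ G.closedNbhd u) ∧
       (∀ w ∈ G.closedNbhd v \ G.closedNbhd u, G.closedNbhd w ⊆ G.closedNbhd v)) := by
  rw [SimpleGraph.bundle_union_bundle_eq_iff]
  constructor
  · intro h
    refine ⟨Set.eq_univ_of_forall fun w => ?_,
      fun w hw => SimpleGraph.closedNbhd_subset_of_forall_isMaxclique h hw.2,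
      fun w hw => SimpleGraph.closedNbhd_subset_of_forall_isMaxclique
        (fun C hC => (h C hC).symm) hw.2⟩
    by_cases hw : w ∈ G.closedNbhd v
    · exact Or.inr hw
    · exact Or.inl (SimpleGraph.closedNbhd_subset_of_forall_isMaxclique h hw (Or.inl rfl))
  · rintro ⟨hcover, -, hc⟩ C hC
    by_cases hu : C ⊆ G.closedNbhd u
    · exact Or.inl (hC.mem_of_subset_closedNbhd hu)
    · obtain ⟨x, hxC, hxu⟩ := Set.not_subset.mp hu
      have hxv : x ∈ G.closedNbhd v :=
        (hcover.symm ▸ Set.mem_univ x : x ∈ G.closedNbhd u ∪ G.closedNbhd v).resolve_left hxu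
      exact Or.inr (hC.mem_of_subset_closedNbhd
        ((hC.1.subset_closedNbhd hxC).trans (hc x ⟨hxv, hxu⟩)))
end

section
/- Let I and J be isomorphic sharp interval systems. For every hypergraph isomorphism ψ from I to J there exists a hypergraph isomorphism ψ' from I to J such that ψ'(A) = ψ(A) for all intervals A ∈ I and, moreover, ψ' respects extreme points: it maps the extreme points (left and right endpoints) of each interval A ∈ I to the extreme points of the interval ψ(A) ∈ J. -/
/-- `A` is an interval of the linearly ordered point set `Fin n`. -/
def IsIntervalF {n : ℕ} (A : Set (Fin n)) : Prop := ∃ a b : Fin n, A = Set.Icc a b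

/-- The extreme points (left and right endpoints) of a set of points on the line. -/
def endPts {n : ℕ} (A : Set (Fin n)) : Set (Fin n) := {x | IsLeast A x ∨ IsGreatest A x}

/-- A *sharp* interval system: `m` intervals on `{1,…,2m}` such that every point
is an extreme point of exactly one interval. -/
def SharpIntervalSys {n : ℕ} (ℐ : Set (Set (Fin n))) : Prop :=
  (∀ A ∈ ℐ, IsIntervalF A) ∧ 2 * Nat.card ℐ = n ∧
    ∀ x : Fin n, ∃! A : Set (Fin n), A ∈ ℐ ∧ x ∈ endPts A

/-- Two sets overlap if they meet and neither contains the other. -/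
def Overlaps {α : Type*} (A B : Set α) : Prop := (A ∩ B).Nonempty ∧ ¬ A ⊆ B ∧ ¬ B ⊆ A

theorem overlaps_image_iff {α β : Type*} {f : α → β} (hf : Function.Injective f)
    {A B : Set α} : Overlaps (f '' A) (f '' B) ↔ Overlaps A B := by
  simp only [Overlaps, ← Set.image_inter hf, Set.image_nonempty, Set.image_subset_image_iff hf]

theorem endPts_Icc {n : ℕ} {l r : Fin n} (h : l ≤ r) : endPts (Set.Icc l r) = {l, r} := by
  ext x
  simp only [endPts, Set.mem_ofPred_eq, Set.mem_insert_iff, Set.mem_singleton_iff]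
  constructor
  · rintro (hx | hx)
    · exact Or.inl (hx.unique (isLeast_Icc h))
    · exact Or.inr (hx.unique (isGreatest_Icc h))
  · rintro (rfl | rfl)
    · exact Or.inl (isLeast_Icc h)
    · exact Or.inr (isGreatest_Icc h)

theorem endPts_Icc_of_not_le {n : ℕ} {l r : Fin n} (h : ¬ l ≤ r) :
    endPts (Set.Icc l r) = ∅ := by
  ext x
  simp [endPts, Set.Icc_eq_empty h, IsLeast, IsGreatest]

theorem IsIntervalF.ncard_endPts_le {n : ℕ} {A : Set (Fin n)} (hA : IsIntervalF A) :
    (endPts A).ncard ≤ 2 := by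
  obtain ⟨l, r, rfl⟩ := hA
  by_cases h : l ≤ r
  · rw [endPts_Icc h]
    exact (Set.ncard_insert_le l {r}).trans (by simp)
  · simp [endPts_Icc_of_not_le h]

namespace SharpIntervalSys

variable {n : ℕ} {ℐ : Set (Set (Fin n))}

theorem eq_of_mem_endPts (hI : SharpIntervalSys ℐ) {A B : Set (Fin n)} (hA : A ∈ ℐ)
    (hB : B ∈ ℐ) {x : Fin n} (hxA : x ∈ endPts A) (hxB : x ∈ endPts B) : A = B :=
  (hI.2.2 x).unique ⟨hA, hxA⟩ ⟨hB, hxB⟩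

/-- The endpoint sets partition the `n` points into `n / 2` sets of size at most two. -/
theorem ncard_endPts (hI : SharpIntervalSys ℐ) {A : Set (Fin n)} (hA : A ∈ ℐ) :
    (endPts A).ncard = 2 := by
  classical
  have : Fintype ℐ := Fintype.ofFinite ℐ
  choose own hown using fun x => (hI.2.2 x).exists
  have hfib : ∀ B : ℐ, (endPts B.1).ncard =
      (Finset.univ.filter fun x => (⟨own x, (hown x).1⟩ : ℐ) = B).card := by
    intro B
    rw [← Set.ncard_coe_finset]
    congr 1
    ext x
    simp only [Finset.coe_filter, Finset.mem_univ, true_and, Set.mem_ofPred_eq]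
    constructor
    · intro hx
      exact Subtype.ext (hI.eq_of_mem_endPts (hown x).1 B.2 (hown x).2 hx)
    · rintro rfl
      exact (hown x).2
  have hsum : ∑ B : ℐ, (endPts B.1).ncard = ∑ _B : ℐ, 2 := by
    simp only [hfib]
    rw [← Finset.card_eq_sum_card_fiberwise (fun x _ => Finset.mem_coe.2 (Finset.mem_univ _))]
    rw [Finset.card_univ, Fintype.card_fin, Finset.sum_const, Finset.card_univ,
      ← Nat.card_eq_fintype_card, smul_eq_mul, mul_comm, hI.2.1]
  exact (Finset.sum_eq_sum_iff_of_le fun B _ => (hI.1 B.1 B.2).ncard_endPts_le).1 hsum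
    ⟨A, hA⟩ (Finset.mem_univ _)

theorem exists_eq_Icc (hI : SharpIntervalSys ℐ) {A : Set (Fin n)} (hA : A ∈ ℐ) :
    ∃ l r : Fin n, l < r ∧ A = Set.Icc l r := by
  have hc := hI.ncard_endPts hA
  obtain ⟨l, r, rfl⟩ := hI.1 A hA
  refine ⟨l, r, ?_, rfl⟩
  by_cases h : l ≤ r
  · refine lt_of_le_of_ne h ?_
    rintro rfl
    rw [endPts_Icc le_rfl] at hc
    simp at hc
  · simp [endPts_Icc_of_not_le h] at hc

/-- Distinct members of a sharp system have no common endpoint. -/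
theorem endpoints_ne (hI : SharpIntervalSys ℐ) {l r c d : Fin n} (hlr : l ≤ r) (hcd : c ≤ d)
    (hA : Set.Icc l r ∈ ℐ) (hB : Set.Icc c d ∈ ℐ) (hne : Set.Icc l r ≠ Set.Icc c d) :
    l ≠ c ∧ l ≠ d ∧ r ≠ c ∧ r ≠ d := by
  have key : ∀ x ∈ endPts (Set.Icc l r), x ∉ endPts (Set.Icc c d) := fun x hx hx' =>
    hne (hI.eq_of_mem_endPts hA hB hx hx')
  simpa [endPts_Icc hlr, endPts_Icc hcd, and_assoc] using key

theorem mem_endpoints_of_overlaps (hI : SharpIntervalSys ℐ) {l r : Fin n} (hlr : l < r)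
    {B : Set (Fin n)} (hB : B ∈ ℐ) (hAB : Overlaps (Set.Icc l r) B) :
    r ∈ B ↔ l ∉ B := by
  obtain ⟨c, d, hcd, rfl⟩ := hI.exists_eq_Icc hB
  obtain ⟨⟨x, hx⟩, h1, h2⟩ := hAB
  rw [Set.Icc_subset_Icc_iff hlr.le] at h1
  rw [Set.Icc_subset_Icc_iff hcd.le] at h2
  simp only [Set.mem_inter_iff, Set.mem_Icc] at hx ⊢
  grind

theorem mem_endpoints_of_not_overlaps (hI : SharpIntervalSys ℐ) {l r : Fin n} (hlr : l < r)
    (hA : Set.Icc l r ∈ ℐ) {B : Set (Fin n)} (hB : B ∈ ℐ) (hAB : ¬ Overlaps (Set.Icc l r) B) :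
    (l ∈ B ↔ Set.Icc l r ⊆ B) ∧ (r ∈ B ↔ Set.Icc l r ⊆ B) := by
  have hl : l ∈ Set.Icc l r := Set.left_mem_Icc.2 hlr.le
  have hr : r ∈ Set.Icc l r := Set.right_mem_Icc.2 hlr.le
  by_cases hne : Set.Icc l r = B
  · subst hne
    simp [hlr.le]
  obtain ⟨c, d, hcd, rfl⟩ := hI.exists_eq_Icc hB
  obtain ⟨h1, h2, h3, h4⟩ := hI.endpoints_ne hlr.le hcd.le hA hB hne
  have key : ∀ x ∈ Set.Icc l r, x ∈ Set.Icc c d → ¬ Set.Icc c d ⊆ Set.Icc l r →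
      Set.Icc l r ⊆ Set.Icc c d := fun x hx hx' hn => by
    by_contra hs
    exact hAB ⟨⟨x, hx, hx'⟩, hs, hn⟩
  rw [Set.Icc_subset_Icc_iff hcd.le] at key
  refine ⟨⟨fun h => key l hl h ?_, fun h => h hl⟩, ⟨fun h => key r hr h ?_, fun h => h hr⟩⟩ <;>
  · simp only [Set.mem_Icc] at h
    grind

theorem same_side_iff (hI : SharpIntervalSys ℐ) {l r : Fin n} (hlr : l < r)
    {B C : Set (Fin n)} (hB : B ∈ ℐ) (hC : C ∈ ℐ)
    (hAB : Overlaps (Set.Icc l r) B) (hAC : Overlaps (Set.Icc l r) C) :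
    (l ∈ B ↔ l ∈ C) ↔ ((B ∩ C) \ Set.Icc l r).Nonempty := by
  have hrB := hI.mem_endpoints_of_overlaps hlr hB hAB
  have hrC := hI.mem_endpoints_of_overlaps hlr hC hAC
  obtain ⟨b, b', hb, rfl⟩ := hI.exists_eq_Icc hB
  obtain ⟨c, c', hc, rfl⟩ := hI.exists_eq_Icc hC
  obtain ⟨-, -, hBA⟩ := hAB
  obtain ⟨-, -, hCA⟩ := hAC
  rw [Set.Icc_subset_Icc_iff hb.le] at hBA
  rw [Set.Icc_subset_Icc_iff hc.le] at hCA
  simp only [Set.mem_Icc] at hrB hrC ⊢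
  constructor
  · intro h
    by_cases hl : b ≤ l ∧ l ≤ b'
    · refine ⟨max b c, ?_⟩
      simp only [Set.mem_sdiff, Set.mem_inter_iff, Set.mem_Icc]
      grind
    · refine ⟨min b' c', ?_⟩
      simp only [Set.mem_sdiff, Set.mem_inter_iff, Set.mem_Icc]
      grind
  · rintro ⟨x, hx⟩
    simp only [Set.mem_sdiff, Set.mem_inter_iff, Set.mem_Icc] at hx
    grind

/-- The endpoints of `A` and of its image under an isomorphism can be matched so that matched
points lie in corresponding hyperedges. -/
theorem exists_matching {𝒥 : Set (Set (Fin n))} (hI : SharpIntervalSys ℐ)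
    (hJ : SharpIntervalSys 𝒥) {ψ : Fin n → Fin n} (hψ : Function.Injective ψ)
    (hmap : ∀ S ∈ ℐ, ψ '' S ∈ 𝒥) {A : Set (Fin n)} (hA : A ∈ ℐ) :
    ∃ p q p' q' : Fin n, p ≠ q ∧ endPts A = {p, q} ∧ endPts (ψ '' A) = {p', q'} ∧
      ∀ B ∈ ℐ, (p ∈ B ↔ p' ∈ ψ '' B) ∧ (q ∈ B ↔ q' ∈ ψ '' B) := by
  have hA' := hmap A hA
  obtain ⟨l, r, hlr, rfl⟩ := hI.exists_eq_Icc hA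
  obtain ⟨l', r', hlr', hAim⟩ := hJ.exists_eq_Icc hA'
  have hend := endPts_Icc hlr.le
  have hend' : endPts (ψ '' Set.Icc l r) = {l', r'} := by rw [hAim, endPts_Icc hlr'.le]
  rw [hAim] at hA'
  have hov : ∀ B, Overlaps (Set.Icc l' r') (ψ '' B) ↔ Overlaps (Set.Icc l r) B := fun B => by
    rw [← hAim, overlaps_image_iff hψ]
  have hout : ∀ B ∈ ℐ, ¬ Overlaps (Set.Icc l r) B →
      (l ∈ B ↔ r ∈ B) ∧ (l ∈ B ↔ l' ∈ ψ '' B) ∧ (r ∈ B ↔ r' ∈ ψ '' B) := by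
    intro B hB hAB
    obtain ⟨h1, h2⟩ := hI.mem_endpoints_of_not_overlaps hlr hA hB hAB
    obtain ⟨h3, h4⟩ := hJ.mem_endpoints_of_not_overlaps hlr' hA' (hmap B hB)
      (fun h => hAB ((hov B).1 h))
    rw [← hAim, Set.image_subset_image_iff hψ] at h3 h4
    tauto
  have hflip : ∀ B ∈ ℐ, Overlaps (Set.Icc l r) B →
      (r ∈ B ↔ l ∉ B) ∧ (r' ∈ ψ '' B ↔ l' ∉ ψ '' B) := fun B hB hAB =>
    ⟨hI.mem_endpoints_of_overlaps hlr hB hAB,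
      hJ.mem_endpoints_of_overlaps hlr' (hmap B hB) ((hov B).2 hAB)⟩
  have hside : ∀ B ∈ ℐ, ∀ C ∈ ℐ, Overlaps (Set.Icc l r) B → Overlaps (Set.Icc l r) C →
      ((l ∈ B ↔ l ∈ C) ↔ (l' ∈ ψ '' B ↔ l' ∈ ψ '' C)) := by
    intro B hB C hC hAB hAC
    rw [hI.same_side_iff hlr hB hC hAB hAC, hJ.same_side_iff hlr' (hmap B hB) (hmap C hC)
      ((hov B).2 hAB) ((hov C).2 hAC), ← hAim, ← Set.image_inter hψ, ← Set.image_sdiff hψ,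
      Set.image_nonempty]
  by_cases hor : ∀ B ∈ ℐ, Overlaps (Set.Icc l r) B → (l ∈ B ↔ l' ∈ ψ '' B)
  · refine ⟨l, r, l', r', hlr.ne, hend, hend', fun B hB => ?_⟩
    by_cases hAB : Overlaps (Set.Icc l r) B
    · have := hor B hB hAB
      have := hflip B hB hAB
      tauto
    · exact (hout B hB hAB).2
  · push Not at hor
    obtain ⟨C, hC, hAC, hCne⟩ := hor
    refine ⟨l, r, r', l', hlr.ne, hend, by rw [hend', Set.pair_comm], fun B hB => ?_⟩
    by_cases hAB : Overlaps (Set.Icc l r) B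
    · have := hside B hB C hC hAB hAC
      have := hflip B hB hAB
      tauto
    · have := hout B hB hAB
      tauto

end SharpIntervalSys

/-- Let `ℐ` and `𝒥` be isomorphic sharp interval systems.  Every hypergraph isomorphism
`ψ : ℐ → 𝒥` can be modified to a hypergraph isomorphism `ψ'` acting identically on
hyperedges (`ψ'(A) = ψ(A)` for all `A ∈ ℐ`) that moreover respects extreme points:
it maps the extreme points of each `A ∈ ℐ` to the extreme points of `ψ(A)`. -/
theorem stmt11 {n : ℕ} (ℐ 𝒥 : Set (Set (Fin n)))
    (hI : SharpIntervalSys ℐ) (hJ : SharpIntervalSys 𝒥)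
    (ψ : Fin n → Fin n) (hbij : Function.Bijective ψ)
    (hiso : ∀ S : Set (Fin n), S ∈ ℐ ↔ ψ '' S ∈ 𝒥) :
    ∃ ψ' : Fin n → Fin n, Function.Bijective ψ' ∧
      (∀ S : Set (Fin n), S ∈ ℐ ↔ ψ' '' S ∈ 𝒥) ∧
      (∀ A ∈ ℐ, ψ' '' A = ψ '' A) ∧
      (∀ A ∈ ℐ, ψ' '' endPts A = endPts (ψ '' A)) := by
  rcases isEmpty_or_nonempty (Fin n) with _ | _
  · exact ⟨ψ, hbij, hiso, fun _ _ => rfl, fun _ _ => Subsingleton.elim _ _⟩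
  have hmap : ∀ S ∈ ℐ, ψ '' S ∈ 𝒥 := fun S hS => (hiso S).1 hS
  have hpre : ∀ T ∈ 𝒥, ∃ S ∈ ℐ, ψ '' S = T := fun T hT =>
    ⟨ψ ⁻¹' T, (hiso _).2 (by rwa [Set.image_preimage_eq T hbij.2]),
      Set.image_preimage_eq T hbij.2⟩
  choose! p q p' q' hpq hend hend' hmem using
    fun A (hA : A ∈ ℐ) => hI.exists_matching hJ hbij.1 hmap hA
  choose own hown using fun x => (hI.2.2 x).exists
  have hown_eq : ∀ A ∈ ℐ, ∀ x ∈ endPts A, own x = A := fun A hA x hx =>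
    hI.eq_of_mem_endPts (hown x).1 hA (hown x).2 hx
  obtain ⟨φ, hφ⟩ : ∃ φ : Fin n → Fin n,
      ∀ x, φ x = if x = p (own x) then p' (own x) else q' (own x) := ⟨_, fun _ => rfl⟩
  have hp : ∀ A ∈ ℐ, φ (p A) = p' A := fun A hA => by
    simp [hφ, hown_eq A hA (p A) (by simp [hend A hA])]
  have hq : ∀ A ∈ ℐ, φ (q A) = q' A := fun A hA => by
    simp [hφ, hown_eq A hA (q A) (by simp [hend A hA]), (hpq A hA).symm]
  have hcase : ∀ x, ∃ A ∈ ℐ, x = p A ∨ x = q A := fun x =>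
    ⟨own x, (hown x).1, by simpa [hend _ (hown x).1] using (hown x).2⟩
  have hsurj : Function.Surjective φ := by
    intro y
    obtain ⟨T, hT, hyT⟩ := (hJ.2.2 y).exists
    obtain ⟨A, hA, rfl⟩ := hpre T hT
    rw [hend' A hA] at hyT
    rcases hyT with rfl | rfl
    · exact ⟨_, hp A hA⟩
    · exact ⟨_, hq A hA⟩
  have hφbij : Function.Bijective φ := Finite.surjective_iff_bijective.1 hsurj
  have htwin : ∀ x, ∀ B ∈ ℐ, (x ∈ B ↔ φ x ∈ ψ '' B) := by
    intro x B hB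
    obtain ⟨A, hA, rfl | rfl⟩ := hcase x
    · rw [hp A hA]
      exact (hmem A hA B hB).1
    · rw [hq A hA]
      exact (hmem A hA B hB).2
  have himage : ∀ A ∈ ℐ, φ '' A = ψ '' A := by
    intro A hA
    rw [← Set.image_preimage_eq (ψ '' A) hsurj]
    congr 1
    ext x
    exact htwin x A hA
  refine ⟨φ, hφbij, fun S => ⟨fun hS => ?_, fun hS => ?_⟩, himage, fun A hA => ?_⟩
  · rw [himage S hS]
    exact hmap S hS
  · obtain ⟨A, hA, hAS⟩ := hpre _ hS
    rw [← himage A hA] at hAS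
    rwa [← hφbij.1.image_injective hAS]
  · rw [hend A hA, hend' A hA, Set.image_pair, hp A hA, hq A hA]
end

section
/- Every finite HCA graph G that has at least one edge contains an essential edge, i.e., an edge uv that is contained in a unique maxclique of G. -/
/-- `α` is an intersection representation of `G`. -/
def IsIntersectionRep {V β : Type*} (G : SimpleGraph V) (α : V → Set β) : Prop :=
  ∀ u v : V, u ≠ v → (G.Adj u v ↔ (α u ∩ α v).Nonempty)

/-- A family of sets has the *Helly property*. -/
def HellyFamily {β : Type*} (F : Set (Set β)) : Prop :=
  ∀ S : Set (Set β), S ⊆ F → S.Nonempty →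
    (∀ A ∈ S, ∀ B ∈ S, (A ∩ B).Nonempty) → (⋂₀ S).Nonempty

/-- The arc `[a,b]` on the `n`-point circle. -/
def arcIcc (n : ℕ) (a b : ZMod n) : Set (ZMod n) := {x | (x - a).val ≤ (b - a).val}

/-- `A` is an arc on the `n`-point circle. -/
def IsArc (n : ℕ) (A : Set (ZMod n)) : Prop := ∃ a b : ZMod n, A = arcIcc n a b

/-- `G` is a Helly circular-arc graph. -/
def IsHCA {V : Type*} (G : SimpleGraph V) : Prop :=
  ∃ n : ℕ, 3 ≤ n ∧ ∃ α : V → Set (ZMod n),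
    IsIntersectionRep G α ∧ (∀ v : V, IsArc n (α v)) ∧ HellyFamily (Set.range α)

theorem arcIcc_subset_arcIcc {n : ℕ} [NeZero n] {a b x y : ZMod n}
    (hxy : (x - a).val ≤ (y - a).val) (hy : y ∈ arcIcc n a b) :
    arcIcc n x y ⊆ arcIcc n a b := by
  intro z hz
  have hy' : (y - a).val ≤ (b - a).val := hy
  have hz' : (z - x).val ≤ (y - x).val := hz
  have h₁ : (y - x).val = (y - a).val - (x - a).val := by
    rw [← ZMod.val_sub hxy, sub_sub_sub_cancel_right]
  have h₂ : (z - a).val ≤ (z - x).val + (x - a).val := by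
    simpa using ZMod.val_add_le (z - x) (x - a)
  change (z - a).val ≤ (b - a).val
  omega

theorem mem_arcIcc_or_mem_arcIcc {n : ℕ} [NeZero n] {x y : ZMod n} (hxy : x ≠ y) (z : ZMod n) :
    z ∈ arcIcc n x y ∨ z ∈ arcIcc n y x := by
  refine or_iff_not_imp_left.2 fun h => ?_
  have h₁ : (y - x).val < (z - x).val := not_le.1 h
  have h₂ : (z - y).val = (z - x).val - (y - x).val := by
    rw [← ZMod.val_sub h₁.le, sub_sub_sub_cancel_right]
  have : NeZero (y - x) := ⟨sub_ne_zero.2 hxy.symm⟩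
  have h₃ : (x - y).val = n - (y - x).val := by
    rw [← ZMod.val_neg_of_ne_zero, neg_sub]
  have h₄ := ZMod.val_lt (z - x)
  change (z - y).val ≤ (x - y).val
  omega

theorem IsArc.arcIcc_subset_or {n : ℕ} [NeZero n] {A : Set (ZMod n)} (hA : IsArc n A)
    {x y : ZMod n} (hx : x ∈ A) (hy : y ∈ A) : arcIcc n x y ⊆ A ∨ arcIcc n y x ⊆ A := by
  obtain ⟨a, b, rfl⟩ := hA
  exact (le_total (x - a).val (y - a).val).imp (arcIcc_subset_arcIcc · hy)
    (arcIcc_subset_arcIcc · hx)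

theorem IsArc.nonempty {n : ℕ} {A : Set (ZMod n)} (hA : IsArc n A) : A.Nonempty := by
  obtain ⟨a, b, rfl⟩ := hA
  exact ⟨a, by simp [arcIcc]⟩

theorem IsArc.exists_first {n : ℕ} [NeZero n] {A P : Set (ZMod n)} (hA : IsArc n A)
    (hP : (A ∩ P).Nonempty) : ∃ i ∈ A ∩ P, ∀ q ∈ A ∩ P, arcIcc n i q ⊆ A := by
  obtain ⟨a, b, rfl⟩ := hA
  obtain ⟨i, hi, hmin⟩ := Set.exists_min_image _ (fun x => (x - a).val) (Set.toFinite _) hP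
  exact ⟨i, hi, fun q hq => arcIcc_subset_arcIcc (hmin q hq) hq.1⟩

theorem SimpleGraph.IsClique.exists_isMaxclique {V : Type*} [Finite V] {G : SimpleGraph V}
    {C : Set V} (hC : G.IsClique C) : ∃ D, C ⊆ D ∧ G.IsMaxclique D := by
  obtain ⟨D, hCD, hD⟩ := (Set.toFinite {D : Set V | G.IsClique D}).exists_le_maximal hC
  exact ⟨D, hCD, hD.prop, fun E hE hDE => (hD.le_of_ge hE hDE).antisymm hDE⟩

section IntersectionRep

variable {V β : Type*} {G : SimpleGraph V} {α : V → Set β}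

theorem IsIntersectionRep.isClique_point (hα : IsIntersectionRep G α) (p : β) :
    G.IsClique {v | p ∈ α v} :=
  fun u hu v hv huv => (hα u v huv).2 ⟨p, hu, hv⟩

theorem IsIntersectionRep.exists_eq_of_isMaxclique (hα : IsIntersectionRep G α)
    (hne : ∀ v, (α v).Nonempty) (hH : HellyFamily (Set.range α)) {C : Set V}
    (hC : G.IsMaxclique C) (hC₀ : C.Nonempty) : ∃ p, {v | p ∈ α v} = C := by
  obtain ⟨p, hp⟩ := hH (α '' C) (Set.image_subset_range _ _) (hC₀.image _) (by
    rintro _ ⟨u, hu, rfl⟩ _ ⟨v, hv, rfl⟩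
    by_cases huv : u = v
    · simpa [huv] using hne v
    · exact (hα u v huv).1 (hC.1 hu hv huv))
  exact ⟨p, hC.2 _ (hα.isClique_point p) fun v hv => hp _ ⟨v, hv, rfl⟩⟩

end IntersectionRep

/-- Every finite HCA graph with at least one edge contains an essential edge:
an edge contained in a unique maxclique. -/
theorem stmt15 {V : Type*} [Fintype V] (G : SimpleGraph V)
    (hHCA : IsHCA G) (hedge : ∃ u v : V, G.Adj u v) :
    ∃ u v : V, G.Adj u v ∧ ∃! C : Set V, G.IsMaxclique C ∧ u ∈ C ∧ v ∈ C := by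
  obtain ⟨n, hn, α, hα, hArc, hH⟩ := hHCA
  have : NeZero n := ⟨by omega⟩
  let C : ZMod n → Set V := fun p => {v | p ∈ α v}
  let P : Set (ZMod n) := {p | G.IsMaxclique (C p) ∧ (C p).Nontrivial}
  have hpoint : ∀ {D : Set V} {u v : V}, G.IsMaxclique D → u ∈ D → v ∈ D → u ≠ v →
      ∃ p ∈ P, C p = D := by
    intro D u v hD hu hv huv
    obtain ⟨p, hp⟩ := hα.exists_eq_of_isMaxclique (fun w => (hArc w).nonempty) hH hD ⟨u, hu⟩
    change C p = D at hp
    subst hp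
    exact ⟨p, ⟨hD, u, hu, v, hv, huv⟩, rfl⟩
  have hmeet : ∀ {u v : V}, G.Adj u v → (α u ∩ P).Nonempty := by
    intro u v huv
    obtain ⟨D, hsub, hD⟩ := (SimpleGraph.isClique_pair.2 fun _ => huv).exists_isMaxclique
    obtain ⟨p, hpP, rfl⟩ := hpoint hD (hsub (by simp)) (hsub (by simp)) huv.ne
    exact ⟨p, hsub (by simp), hpP⟩
  -- It suffices to find a point at which all maxcliques through `u` and `v` live.
  have hfinish : ∀ {u v : V} {i : ZMod n}, u ≠ v → i ∈ P → i ∈ α u → i ∈ α v →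
      (∀ q ∈ P, q ∈ α u → q ∈ α v → C q = C i) →
      ∃ u v : V, G.Adj u v ∧ ∃! D : Set V, G.IsMaxclique D ∧ u ∈ D ∧ v ∈ D := by
    intro u v i huv hi hiu hiv h
    refine ⟨u, v, (hα u v huv).2 ⟨i, hiu, hiv⟩, C i, ⟨hi.1, hiu, hiv⟩, ?_⟩
    rintro D ⟨hD, hu, hv⟩
    obtain ⟨q, hq, rfl⟩ := hpoint hD hu hv huv
    exact h q hq hu hv
  -- `M` is a non-isolated vertex meeting as few points of `P` as possible.
  obtain ⟨u₀, v₀, h₀⟩ := hedge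
  obtain ⟨M, hM, hmin⟩ := Set.exists_min_image {v | (α v ∩ P).Nonempty}
    (fun v => (α v ∩ P).ncard) (Set.toFinite _) ⟨u₀, hmeet h₀⟩
  obtain ⟨i, ⟨hiM, hiP⟩, hfirst⟩ := (hArc M).exists_first hM
  obtain ⟨w, hw, hwM⟩ := hiP.2.exists_ne M
  by_cases hother : {p | p ∈ P ∧ C p ≠ C i}.Nonempty
  swap
  · refine hfinish hwM hiP hw hiM fun q hq _ _ => ?_
    by_contra hne
    exact hother ⟨q, hq, hne⟩
  obtain ⟨j, ⟨hjP, hji⟩, hnext⟩ := Set.exists_min_image _ (fun p => (p - i).val)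
    (Set.toFinite _) hother
  have hbetween : ∀ q ∈ P, C q ≠ C i → j ∈ arcIcc n i q := fun q hq hne => hnext q ⟨hq, hne⟩
  obtain ⟨L, hLi, hLj⟩ : ∃ L ∈ C i, L ∉ C j := by
    by_contra! hsub
    exact hji (hiP.1.2 _ hjP.1.1 hsub)
  by_cases hLM : L = M
  · subst hLM
    refine hfinish hwM hiP hw hiM fun q hq _ hqL => ?_
    by_contra hne
    exact hLj (hfirst q ⟨hqL, hq⟩ (hbetween q hq hne))
  refine hfinish hLM hiP hLi hiM fun q hq hqL hqM => ?_
  by_contra hne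
  have hiq : i ≠ q := fun h => hne (h ▸ rfl)
  have hqi : arcIcc n q i ⊆ α L :=
    ((hArc L).arcIcc_subset_or hLi hqL).resolve_left fun h => hLj (h (hbetween q hq hne))
  have hcover : ∀ z, z ∉ α L → z ∈ α M := fun z hz =>
    (mem_arcIcc_or_mem_arcIcc hiq z).elim (fun h => hfirst q ⟨hqM, hq⟩ h) fun h => absurd (hqi h) hz
  -- Hence `L` is adjacent to every vertex of `C j`, so it belongs to that maxclique.
  have hadj : ∀ x ∈ C j, L ≠ x → G.Adj L x := by
    intro x hx hLx
    refine (hα L x hLx).2 (Set.not_disjoint_iff_nonempty_inter.1 fun hdisj => ?_)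
    refine (hmin x ⟨j, hx, hjP⟩).not_gt (Set.ncard_lt_ncard ?_ (Set.toFinite _))
    have hsub : α x ∩ P ⊆ α M ∩ P := fun z hz =>
      ⟨hcover z fun hzL => hdisj.le_bot ⟨hzL, hz.1⟩, hz.2⟩
    refine (Set.ssubset_iff_of_subset hsub).2 ?_
    exact ⟨i, ⟨hiM, hiP⟩, fun hix => hdisj.le_bot ⟨hLi, hix.1⟩⟩
  exact hLj (hjP.1.2 _ (hjP.1.1.insert hadj) (Set.subset_insert _ _) ▸ Set.mem_insert L (C j))
end

section
/- Let G be a finite simple graph without universal vertices and let α : V(G) → A be an intersection representation of G onto a sharp arc system A satisfying the Helly property. Let C be a maxclique of G. Then the C-flipped system A^{α(C)} is an interval system in the following sense: there exist two consecutive points x and y on the circle (y the successor of x) such that no arc I ∈ A^{α(C)} contains both x and y, unless I is the complete arc with designated extreme points x and y obtained by flipping the two-point arc [x,y]. -/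
/-- The point set of an arc given with its designated extreme points `p = (p.1, p.2)`. -/
def arcPts {n : ℕ} (p : ZMod n × ZMod n) : Set (ZMod n) := arcIcc n p.1 p.2

/-- The flip of the arc `[a,b]` is the arc `[b,a]`. -/
def flipArc {n : ℕ} (p : ZMod n × ZMod n) : ZMod n × ZMod n := (p.2, p.1)

/-- The `X`-flipped system `𝒜^X`: replace every arc of `X ⊆ 𝒜` by its flip. -/
def flipSys {n : ℕ} (𝒜 X : Set (ZMod n × ZMod n)) : Set (ZMod n × ZMod n) :=
  (𝒜 \ X) ∪ (flipArc '' X)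

/-- A system of arcs-with-extreme-points is *sharp*. -/
def SharpSys {m : ℕ} (P : Set (ZMod m × ZMod m)) : Prop :=
  2 * Nat.card P = m ∧ ∀ x : ZMod m, ∃! p, p ∈ P ∧ (p.1 = x ∨ p.2 = x)

theorem eq_extreme_of_mem_arcIcc_of_mem_flip {n : ℕ} [NeZero n] {x a b : ZMod n}
    (h₁ : x ∈ arcIcc n a b) (h₂ : x ∈ arcIcc n b a) : a = x ∨ b = x := by
  simp only [arcIcc, Set.mem_ofPred_eq] at h₁ h₂
  by_contra! h
  obtain ⟨ha, hb⟩ := h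
  have hxa : x - a ≠ 0 := sub_ne_zero.2 ha.symm
  have hba : b - a ≠ 0 := fun h0 => by
    rw [h0, ZMod.val_zero, Nat.le_zero, ZMod.val_eq_zero] at h₁
    exact hxa h₁
  have hlt : (x - a).val < (b - a).val :=
    lt_of_le_of_ne h₁ fun h => hb.symm (sub_left_injective (ZMod.val_injective n h))
  have hpos : 0 < (x - a).val := ZMod.val_pos.2 hxa
  have e₁ : (b - x).val = (b - a).val - (x - a).val := by
    rw [← ZMod.val_sub hlt.le]
    congr 1
    ring
  have hbx : b - x ≠ 0 := sub_ne_zero.2 hb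
  rw [← neg_sub b x, ← neg_sub b a, ZMod.neg_val, ZMod.neg_val, if_neg hbx, if_neg hba] at h₂
  have := ZMod.val_lt (b - a)
  omega

theorem add_one_eq_of_mem_arcIcc {n : ℕ} [NeZero n] {x b : ZMod n}
    (h : x + 1 ∈ arcIcc n b x) : b = x + 1 := by
  simp only [arcIcc, Set.mem_ofPred_eq] at h
  rw [show x + 1 - b = x - b + 1 by ring] at h
  by_contra hne
  have hw : x - b + 1 ≠ 0 := fun h0 => hne (by linear_combination -h0)
  have hlt : (x - b).val + 1 < n := by
    refine lt_of_le_of_ne (ZMod.val_lt _) fun he => hw ?_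
    have := congrArg (Nat.cast : ℕ → ZMod n) he
    simpa using this
  have : (x - b + 1).val = (x - b).val + 1 := by
    rw [← ZMod.val_cast_of_lt hlt]
    simp
  omega

theorem sub_one_eq_of_mem_arcIcc {n : ℕ} [NeZero n] {x a : ZMod n}
    (h : x - 1 ∈ arcIcc n x a) : a = x - 1 := by
  simp only [arcIcc, Set.mem_ofPred_eq] at h
  by_contra hne
  have hw : a - x + 1 ≠ 0 := fun h0 => hne (by linear_combination h0)
  have h1 : (1 : ZMod n) ≠ 0 := fun h1 => by
    have : Subsingleton (ZMod n) := subsingleton_of_zero_eq_one h1.symm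
    exact hne (Subsingleton.elim _ _)
  rw [show x - 1 - x = -1 by ring, show a - x = -(x - a) by ring] at h
  have e : a - x + 1 = (a - x) - (-1) := by ring
  have hle : (a - x).val ≤ (-1 : ZMod n).val := by
    obtain ⟨m, rfl⟩ := Nat.exists_eq_succ_of_ne_zero (NeZero.ne n)
    rw [ZMod.val_neg_one]
    exact Nat.le_of_lt_succ (ZMod.val_lt _)
  rw [neg_sub] at h
  exact hw (by rw [e, ZMod.val_injective n (le_antisymm hle h), sub_self])

theorem extreme_mem_arcPts {n : ℕ} {p : ZMod n × ZMod n} {x : ZMod n}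
    (h : p.1 = x ∨ p.2 = x) : x ∈ arcPts p := by
  rcases h with rfl | rfl <;> simp [arcPts, arcIcc]

theorem SimpleGraph.IsMaxclique.mem_of_forall_adj {V : Type*} {G : SimpleGraph V} {C : Set V}
    (hC : G.IsMaxclique C) {v : V} (hv : ∀ u ∈ C, v ≠ u → G.Adj v u) : v ∈ C :=
  hC.2 (insert v C) (hC.1.insert hv) (Set.subset_insert v C) ▸ Set.mem_insert v C

/-- In a Helly representation by nonempty sets, some point lies in exactly the sets that
represent a given maxclique. -/
theorem SimpleGraph.IsMaxclique.exists_forall_mem_iff {V β : Type*} [Nonempty V]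
    {G : SimpleGraph V} {C : Set V} (hC : G.IsMaxclique C) {f : V → Set β}
    (hf : ∀ v, (f v).Nonempty) (hrep : IsIntersectionRep G f)
    (hHelly : HellyFamily {S | ∃ v : V, S = f v}) :
    ∃ x, ∀ v, x ∈ f v ↔ v ∈ C := by
  have hne : C.Nonempty := by
    by_contra h
    obtain ⟨v⟩ := ‹Nonempty V›
    rw [Set.not_nonempty_iff_eq_empty] at h
    have : v ∈ C := hC.mem_of_forall_adj (by simp [h])
    simp [h] at this
  obtain ⟨x, hx⟩ := hHelly (f '' C) (by rintro _ ⟨v, -, rfl⟩; exact ⟨v, rfl⟩) (hne.image f) (by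
    rintro _ ⟨u, hu, rfl⟩ _ ⟨v, hv, rfl⟩
    rcases eq_or_ne u v with rfl | huv
    · simpa using hf u
    · exact (hrep u v huv).1 (hC.1 hu hv huv))
  have hx' : ∀ v ∈ C, x ∈ f v := fun v hv => hx _ ⟨v, hv, rfl⟩
  exact ⟨x, fun v => ⟨fun hv => hC.mem_of_forall_adj fun u hu hvu =>
    (hrep v u hvu).2 ⟨x, hv, hx' u hu⟩, hx' v⟩⟩

/-- Let `α` be an intersection representation of a graph `G` without universal vertices
onto a sharp Helly arc system, and let `C` be a maxclique of `G`.  Then the `C`-flipped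
system `𝒜^{α(C)}` is an interval system: there are consecutive points `x` and `y = x + 1`
such that no arc of `𝒜^{α(C)}` contains both `x` and `y`, except the complete arc with
designated extreme points `y, x` obtained by flipping the two-point arc `[x,y]`. -/
theorem stmt16 {V : Type*} [Fintype V] (G : SimpleGraph V)
    (hUniv : ∀ u : V, G.closedNbhd u ≠ Set.univ)
    (n : ℕ) (hn : 3 ≤ n)
    (α : V → ZMod n × ZMod n)
    (hrep : IsIntersectionRep G (fun v => arcPts (α v)))
    (hsharp : SharpSys (Set.range α))
    (hHelly : HellyFamily {S | ∃ v : V, S = arcPts (α v)})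
    (C : Set V) (hC : G.IsMaxclique C) :
    ∃ x y : ZMod n, y = x + 1 ∧
      ∀ p ∈ flipSys (Set.range α) (α '' C),
        x ∈ arcPts p → y ∈ arcPts p → p = (y, x) := by
  have : NeZero n := ⟨by omega⟩
  have : Nonempty V := by
    obtain ⟨_, ⟨⟨v, -⟩, -⟩, -⟩ := hsharp.2 0
    exact ⟨v⟩
  obtain ⟨x, hx⟩ := hC.exists_forall_mem_iff
    (fun v => ⟨(α v).1, extreme_mem_arcPts (Or.inl rfl)⟩) hrep hHelly
  obtain ⟨q, ⟨-, hq⟩, huniq⟩ := hsharp.2 x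
  have key : ∀ p ∈ flipSys (Set.range α) (α '' C), x ∈ arcPts p → p = flipArc q := by
    rintro p (⟨⟨v, rfl⟩, hv⟩ | ⟨_, ⟨v, hv, rfl⟩, rfl⟩) hxp
    · exact absurd ⟨v, (hx v).1 hxp, rfl⟩ hv
    · rw [huniq (α v) ⟨⟨v, rfl⟩, eq_extreme_of_mem_arcIcc_of_mem_flip ((hx v).2 hv) hxp⟩]
  obtain ⟨a, b⟩ := q
  rcases hq with rfl | rfl
  · refine ⟨a, a + 1, rfl, fun p hp h₁ h₂ => ?_⟩
    obtain rfl := key p hp h₁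
    exact Prod.ext (add_one_eq_of_mem_arcIcc h₂) rfl
  · refine ⟨b - 1, b, (sub_add_cancel b 1).symm, fun p hp h₁ h₂ => ?_⟩
    obtain rfl := key p hp h₂
    exact Prod.ext rfl (sub_one_eq_of_mem_arcIcc h₁)
end
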